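/- Zero-curvature representation of the Heisenberg magnet as the 1-site case of the 1+1 rational sl(2) Gaudin model (Section 4.1): Let z₁ ∈ ℂ, k ∈ ℂ and λ ∈ ℂ nonzero. Let S : ℝ² → Mat₂(ℂ) be twice continuously differentiable, traceless, with (S(x,t))² = λ² · Id for all (x,t). Define η = −(k/(4λ²)) [S, ∂_x S], L(x,t,z) = S/(z − z₁) and M̃(x,t,z) = S/(z − z₁)² + η/(z − z₁). Then the zero-curvature equation ∂_t L − k ∂_x M̃ = [L, M̃] holds for all (x,t) and all z ∈ ℂ ∖ {z₁}, if and only if S satisfies the Heisenberg magnet equation ∂_t S + (k²/(4λ²)) [S, ∂_x² S] = 0 for all (x,t). -/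

import Mathlib

open scoped BigOperators
open Matrix

noncomputable section

/-- Entrywise partial derivative in the first (space) variable. -/
def mdx (S : ℝ → ℝ → Matrix (Fin 2) (Fin 2) ℂ) (x t : ℝ) : Matrix (Fin 2) (Fin 2) ℂ :=
  Matrix.of fun i j => deriv (fun x' => S x' t i j) x

/-- Entrywise partial derivative in the second (time) variable. -/
def mdt (S : ℝ → ℝ → Matrix (Fin 2) (Fin 2) ℂ) (x t : ℝ) : Matrix (Fin 2) (Fin 2) ℂ :=
  Matrix.of fun i j => deriv (fun t' => S x t' i j) t

/-- Entrywise second partial derivative in the first (space) variable. -/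
def mdxx (S : ℝ → ℝ → Matrix (Fin 2) (Fin 2) ℂ) (x t : ℝ) : Matrix (Fin 2) (Fin 2) ℂ :=
  Matrix.of fun i j => deriv (fun x' => deriv (fun x'' => S x'' t i j) x') x

section Helpers

variable {S : ℝ → ℝ → Matrix (Fin 2) (Fin 2) ℂ}

theorem hm_slice (hS : ∀ i j, ContDiff ℝ 2 (fun p : ℝ × ℝ => S p.1 p.2 i j)) (t : ℝ) (i j : Fin 2) :
    ContDiff ℝ 2 (fun x => S x t i j) :=
  (hS i j).comp (contDiff_id.prodMk contDiff_const)

theorem hm_d1 (hS : ∀ i j, ContDiff ℝ 2 (fun p : ℝ × ℝ => S p.1 p.2 i j)) (x t : ℝ) (i j : Fin 2) :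
    HasDerivAt (fun x' => S x' t i j) (mdx S x t i j) x :=
  ((hm_slice hS t i j).differentiable (by norm_num) x).hasDerivAt

theorem hm_d2 (hS : ∀ i j, ContDiff ℝ 2 (fun p : ℝ × ℝ => S p.1 p.2 i j)) (x t : ℝ) (i j : Fin 2) :
    HasDerivAt (fun x' => mdx S x' t i j) (mdxx S x t i j) x := by
  have h : ContDiff ℝ 1 (deriv (fun x => S x t i j)) :=
    ContDiff.deriv' (n := 1) (by simpa [one_add_one_eq_two] using hm_slice hS t i j)
  exact (h.differentiable (by norm_num) x).hasDerivAt

theorem hm_mdt (c : ℂ) (hS : ∀ i j, ContDiff ℝ 2 (fun p : ℝ × ℝ => S p.1 p.2 i j)) (x t : ℝ) :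
    mdt (fun x' t' => c • S x' t') x t = c • mdt S x t := by
  ext i j
  have h : ContDiff ℝ 2 (fun t => S x t i j) :=
    (hS i j).comp (contDiff_const.prodMk contDiff_id)
  have := ((h.differentiable (by norm_num) t).hasDerivAt.const_mul c).deriv
  simpa [mdt] using this

theorem hm_anti (mu : ℂ) (hS : ∀ i j, ContDiff ℝ 2 (fun p : ℝ × ℝ => S p.1 p.2 i j))
    (hsq : ∀ x t, S x t * S x t = mu • (1 : Matrix (Fin 2) (Fin 2) ℂ)) (x t : ℝ) :
    mdx S x t * S x t = - (S x t * mdx S x t) := by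
  rw [eq_neg_iff_add_eq_zero]
  ext i j
  have h1 : HasDerivAt (fun x' => S x' t i 0 * S x' t 0 j + S x' t i 1 * S x' t 1 j) _ x :=
    ((hm_d1 hS x t i 0).mul (hm_d1 hS x t 0 j)).add ((hm_d1 hS x t i 1).mul (hm_d1 hS x t 1 j))
  have h2 : (fun x' => S x' t i 0 * S x' t 0 j + S x' t i 1 * S x' t 1 j)
      = fun _ => (mu • (1 : Matrix (Fin 2) (Fin 2) ℂ)) i j := by
    funext x'
    rw [← hsq x' t, Matrix.mul_apply, Fin.sum_univ_two]
  rw [h2] at h1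
  have h3 := h1.unique (hasDerivAt_const x _)
  simp only [Matrix.add_apply, Matrix.mul_apply, Fin.sum_univ_two, Matrix.zero_apply]
  linear_combination h3

theorem hm_mdx (a b c : ℂ) (hS : ∀ i j, ContDiff ℝ 2 (fun p : ℝ × ℝ => S p.1 p.2 i j)) (x t : ℝ) :
    mdx (fun x' t' => a • S x' t' + b • (c • (S x' t' * mdx S x' t' - mdx S x' t' * S x' t'))) x t
      = a • mdx S x t + b • (c • (S x t * mdxx S x t - mdxx S x t * S x t)) := by
  ext i j
  have d1 := hm_d1 hS x t
  have d2 := hm_d2 hS x t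
  have h := ((d1 i j).const_mul a).add ((((((d1 i 0).mul (d2 0 j)).add ((d1 i 1).mul (d2 1 j))).sub
    (((d2 i 0).mul (d1 0 j)).add ((d2 i 1).mul (d1 1 j)))).const_mul c).const_mul b)
  refine (Eq.trans ?_ h.deriv).trans ?_
  · change deriv _ x = deriv _ x
    congr 1
    funext x'
    simp [Matrix.mul_apply, Fin.sum_univ_two]
  simp only [Matrix.add_apply, Matrix.sub_apply, Matrix.smul_apply, Matrix.mul_apply,
    Fin.sum_univ_two, smul_eq_mul]
  ring

theorem hm_comm (a b k lam : ℂ) (hlam : lam ≠ 0) (A D : Matrix (Fin 2) (Fin 2) ℂ)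
    (hsq : A * A = (lam ^ 2) • (1 : Matrix (Fin 2) (Fin 2) ℂ)) (hanti : D * A = -(A * D)) :
    (b • A) * (a • A + b • ((-(k / (4 * lam ^ 2))) • (A * D - D * A)))
      - (a • A + b • ((-(k / (4 * lam ^ 2))) • (A * D - D * A))) * (b • A)
      = -(k * b ^ 2) • D := by
  have h1 : A * (A * D) = lam ^ 2 • D := by rw [← mul_assoc, hsq]; simp
  have h2 : A * D * A = - (lam ^ 2 • D) := by rw [mul_assoc, hanti, mul_neg, h1]
  simp only [hanti, mul_add, add_mul, smul_mul_assoc, mul_smul_comm, mul_sub, sub_mul, mul_neg,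
    neg_mul, h1, h2]
  ext i j
  simp only [Matrix.add_apply, Matrix.sub_apply, Matrix.smul_apply, Matrix.neg_apply, smul_eq_mul]
  field_simp
  ring

end Helpers

/-- **Section 4.1** (Heisenberg magnet as the 1-site 1+1 rational sl(2) Gaudin model):
the zero-curvature equation `∂_t L − k ∂_x M̃ = [L, M̃]` holds iff `S` satisfies the
Heisenberg magnet equation `∂_t S + (k²/(4λ²))[S, ∂_x² S] = 0`. -/
theorem heisenberg_magnet_zero_curvature
    (z₁ : ℂ) (k : ℂ) (lam : ℂ) (hlam : lam ≠ 0)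
    (S : ℝ → ℝ → Matrix (Fin 2) (Fin 2) ℂ)
    (hS : ∀ i j, ContDiff ℝ 2 (fun p : ℝ × ℝ => S p.1 p.2 i j))
    (htr : ∀ x t, Matrix.trace (S x t) = 0)
    (hsq : ∀ x t, S x t * S x t = (lam ^ 2) • (1 : Matrix (Fin 2) (Fin 2) ℂ)) :
    (∀ x t : ℝ, ∀ w : ℂ, w ≠ z₁ →
        mdt (fun x' t' => (w - z₁)⁻¹ • S x' t') x t
          - k • mdx (fun x' t' =>
              ((w - z₁) ^ 2)⁻¹ • S x' t'
                + (w - z₁)⁻¹ • ((-(k / (4 * lam ^ 2)))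
                    • (S x' t' * mdx S x' t' - mdx S x' t' * S x' t'))) x t
          = ((w - z₁)⁻¹ • S x t)
                * (((w - z₁) ^ 2)⁻¹ • S x t
                    + (w - z₁)⁻¹ • ((-(k / (4 * lam ^ 2)))
                        • (S x t * mdx S x t - mdx S x t * S x t)))
              - (((w - z₁) ^ 2)⁻¹ • S x t
                    + (w - z₁)⁻¹ • ((-(k / (4 * lam ^ 2)))
                        • (S x t * mdx S x t - mdx S x t * S x t)))
                * ((w - z₁)⁻¹ • S x t))
    ↔ (∀ x t : ℝ,
        mdt S x t
            + (k ^ 2 / (4 * lam ^ 2)) • (S x t * mdxx S x t - mdxx S x t * S x t)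
          = 0) := by
  simp only [hm_mdt _ hS, hm_mdx _ _ _ hS,
    hm_comm _ _ k lam hlam _ _ (hsq _ _) (hm_anti _ hS hsq _ _)]
  have key : ∀ (x t : ℝ) (b : ℂ),
      b • mdt S x t - k • ((b ^ 2) • mdx S x t
        + b • ((-(k / (4 * lam ^ 2))) • (S x t * mdxx S x t - mdxx S x t * S x t)))
      = b • (mdt S x t + (k ^ 2 / (4 * lam ^ 2)) • (S x t * mdxx S x t - mdxx S x t * S x t))
        + -(k * b ^ 2) • mdx S x t := by
    intro x t b
    generalize S x t * mdxx S x t - mdxx S x t * S x t = C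
    ext i j
    simp only [Matrix.add_apply, Matrix.sub_apply, Matrix.smul_apply, smul_eq_mul]
    ring
  simp only [← inv_pow, key, add_eq_right]
  constructor
  · intro h x t
    have h1 := h x t (z₁ + 1) (by simp)
    simpa using h1
  · intro h x t w _
    rw [h x t, smul_zero]

end
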